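/- Let t ∈ {2,…,m−1} and for each μ ∈ V^t let B_μ be a μ-component of order t−1. Then the set B = ∪_{μ∈V^t} B_μ is a component of order t. -/

import Mathlib

open Finset Pointwise

abbrev Word (n : ℕ) := Fin n → ZMod 2

def FEv (n : ℕ) : Set (Word n) := {x | Even (hammingNorm x)}

def FOd (n : ℕ) : Set (Word n) := {x | ¬ Even (hammingNorm x)}

def nbr {n : ℕ} (S : Set (Word n)) : Set (Word n) := {y | ∃ x ∈ S, hammingDist y x = 1}

def theta {n : ℕ} (G : Set (Word n)) : Set (Word n) :=
  {x | Even (hammingNorm x) ∧ nbr {x} ⊆ nbr G}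

def ExtPerfect {n : ℕ} (C : Set (Word n)) : Prop :=
  C ⊆ FEv n ∧ (∀ x ∈ C, ∀ y ∈ C, x ≠ y → Disjoint (nbr {x}) (nbr {y})) ∧ nbr C = FOd n

def IsIsometry {n : ℕ} (g : Word n → Word n) : Prop :=
  Function.Bijective g ∧ ∀ x y, hammingDist (g x) (g y) = hammingDist x y

def embWord (m t : ℕ) (v : Word (2 ^ (m - t))) : Word (2 ^ m) := fun i =>
  if h : (i : ℕ) < 2 ^ (m - t) then v ⟨i, h⟩
  else if h2 : (i : ℕ) < 2 * 2 ^ (m - t) then v ⟨(i : ℕ) - 2 ^ (m - t), by omega⟩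
  else 0

def Vt (m t : ℕ) : Set (Word (2 ^ m)) :=
  {x | ∃ v : Word (2 ^ (m - t)), Even (hammingNorm v) ∧ x = embWord m t v}

def At (m : ℕ) : ℕ → Set (Word (2 ^ m))
  | 0 => {0}
  | 1 => Vt m 1
  | t + 2 => Vt m (t + 2) + At m (t + 1)

def IsComp (m t : ℕ) (G : Set (Word (2 ^ m))) : Prop :=
  G ⊆ FEv (2 ^ m) ∧ G.ncard = (At m t).ncard ∧ nbr G = nbr (At m t)

def IsMuComp (m t : ℕ) (μ : Word (2 ^ m)) (M : Set (Word (2 ^ m))) : Prop :=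
  (∀ i : Fin (2 ^ m), 2 ^ (m - t) ≤ (i : ℕ) → μ i = 0) ∧
  ∃ G, IsComp m t G ∧ M = (fun x => μ + x) '' G

def arrEntry (m t : ℕ) (x : Word (2 ^ m)) (i : Fin (2 ^ t)) (j : Fin (2 ^ (m - t))) : ZMod 2 :=
  x ⟨((i : ℕ) * 2 ^ (m - t) + (j : ℕ)) % 2 ^ m, Nat.mod_lt _ (Nat.two_pow_pos m)⟩

def pchk (m t : ℕ) (x : Word (2 ^ m)) : Word (2 ^ (m - t)) :=
  fun j => ∑ i : Fin (2 ^ t), arrEntry m t x i j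

def Bt (m : ℕ) : ℕ → Set (Word (2 ^ m))
  | 0 => Vt m 1
  | 1 => Vt m 1
  | t + 2 => Vt m (t + 2) + theta (At m (t + 1))

/-- The sum of the coordinates of `x` whose index is congruent to `j` modulo `K`. -/
def colSum {n : ℕ} (K : ℕ) (x : Word n) (j : ℕ) : ZMod 2 :=
  ∑ i ∈ Finset.univ.filter (fun i : Fin n => (i : ℕ) % K = j), x i

lemma colSum_add {n : ℕ} (K : ℕ) (x y : Word n) (j : ℕ) :
    colSum K (x + y) j = colSum K x j + colSum K y j := by
  simp [colSum, Finset.sum_add_distrib]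

lemma colSum_single {n : ℕ} (K : ℕ) (i : Fin n) (j : ℕ) :
    colSum K (Pi.single i 1 : Word n) j = if (i : ℕ) % K = j then 1 else 0 := by
  simp [colSum, Pi.single_apply]

/-- A word supported on the first `K` coordinates is determined by its column sums. -/
lemma colSum_eq_apply {n K : ℕ} {x : Word n} (hx : ∀ i : Fin n, K ≤ (i : ℕ) → x i = 0)
    (i : Fin n) (hi : (i : ℕ) < K) : colSum K x i = x i := by
  rw [colSum, Finset.sum_eq_single i]
  · intro b hb hbi
    apply hx
    by_contra! h
    simp only [mem_filter, mem_univ, true_and, Nat.mod_eq_of_lt h] at hb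
    exact hbi (Fin.ext hb)
  · intro h
    simp [Nat.mod_eq_of_lt hi] at h

lemma even_hammingNorm_iff {n : ℕ} (x : Word n) :
    Even (hammingNorm x) ↔ colSum 1 x 0 = 0 := by
  have two : ∀ p : ZMod 2, p ≠ 0 → p = 1 := by decide
  have h : ((hammingNorm x : ℕ) : ZMod 2) = colSum 1 x 0 := by
    simp only [hammingNorm, colSum, Nat.mod_one, Finset.filter_true, Finset.card_filter,
      Nat.cast_sum]
    refine Finset.sum_congr rfl fun i _ => ?_
    by_cases hi : x i = 0
    · simp [hi]
    · simp [two _ hi]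
  rw [← h, ZMod.natCast_eq_zero_iff_even]

lemma hammingDist_eq_one_iff {n : ℕ} (x y : Word n) :
    hammingDist y x = 1 ↔ ∃ i, y = x + Pi.single i 1 := by
  have key : ∀ a b : ZMod 2, a ≠ b → a = b + 1 := by decide
  constructor
  · intro h
    obtain ⟨i, hi⟩ := Finset.card_eq_one.mp h
    refine ⟨i, funext fun k => ?_⟩
    have hk : y k ≠ x k ↔ k = i := by simpa using Finset.ext_iff.mp hi k
    by_cases hki : k = i
    · subst hki
      simpa using key _ _ (hk.2 rfl)
    · simpa [hki] using hk
  · rintro ⟨i, rfl⟩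
    refine Finset.card_eq_one.mpr ⟨i, ?_⟩
    ext k
    simp [Pi.single_apply]

lemma nbr_image_add {n : ℕ} (μ : Word n) (S : Set (Word n)) :
    nbr ((fun x => μ + x) '' S) = (fun x => μ + x) '' nbr S := by
  ext y
  simp only [nbr, Set.mem_image, Set.mem_ofPred_eq, hammingDist_eq_one_iff]
  constructor
  · rintro ⟨_, ⟨x, hx, rfl⟩, i, rfl⟩
    exact ⟨x + Pi.single i 1, ⟨x, hx, i, rfl⟩, (add_assoc _ _ _).symm⟩
  · rintro ⟨_, ⟨x, hx, i, rfl⟩, rfl⟩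
    exact ⟨_, ⟨x, hx, rfl⟩, i, (add_assoc _ _ _).symm⟩

lemma nbr_biUnion {n : ℕ} (V : Set (Word n)) (B : Word n → Set (Word n)) :
    nbr (⋃ μ ∈ V, B μ) = ⋃ μ ∈ V, nbr (B μ) := by
  ext y
  simp only [nbr, Set.mem_iUnion, Set.mem_ofPred_eq]
  grind

/-- If every neighbour of `x` is a neighbour of a set with vanishing column sums, then the column
sums of `x` vanish. -/
lemma colSum_eq_zero_of_nbr {n K : ℕ} (hK : 3 ≤ K) (hKn : K ≤ n) {S : Set (Word n)}
    (hS : ∀ s ∈ S, ∀ j, colSum K s j = 0) {x : Word n}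
    (hx : ∀ i, x + Pi.single i 1 ∈ nbr S) {a : ℕ} (ha : a < K) : colSum K x a = 0 := by
  have key : ∀ l < K, ∃ c, ∀ j,
      colSum K x j + (if l = j then 1 else 0) = if c = j then 1 else 0 := by
    intro l hl
    obtain ⟨s, hs, hd⟩ := hx ⟨l, hl.trans_le hKn⟩
    obtain ⟨i, hi⟩ := (hammingDist_eq_one_iff _ _).mp hd
    refine ⟨(i : ℕ) % K, fun j => ?_⟩
    have := congrArg (fun w => colSum K w j) hi
    simpa [colSum_add, colSum_single, hS s hs, Nat.mod_eq_of_lt hl] using this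
  have two : ∀ p : ZMod 2, p ≠ 0 → p = 1 := by decide
  have step : ∀ l < K, ∀ j, l ≠ a → j ≠ a → l ≠ j → colSum K x a ≠ 0 →
      colSum K x j = 0 ∧ colSum K x l ≠ 0 := by
    intro l hl j hla hja hlj h
    obtain ⟨c, hc⟩ := key l hl
    have h1 := hc a
    have hca : c = a := by
      by_contra hca
      simp [hla, hca, h] at h1
    subst hca
    have h2 := hc j
    have h3 := hc l
    refine ⟨by simpa [hlj, hja.symm] using h2, fun h0 => ?_⟩
    simp [h0, hla.symm] at h3
  by_contra h
  obtain ⟨l, j, hl, hj, hla, hja, hlj⟩ :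
      ∃ l j, l < K ∧ j < K ∧ l ≠ a ∧ j ≠ a ∧ l ≠ j := by
    rcases Nat.lt_or_ge a 1 with h0 | h0
    · exact ⟨1, 2, by omega⟩
    rcases Nat.lt_or_ge a 2 with h1 | h1
    · exact ⟨0, 2, by omega⟩
    · exact ⟨0, 1, by omega⟩
  exact (step j hj l hja hla hlj.symm h).2 (step l hl j hla hja hlj h).1

lemma two_mul_two_pow_sub_le {m t : ℕ} (hm : 1 ≤ m) (ht : 1 ≤ t) : 2 * 2 ^ (m - t) ≤ 2 ^ m := by
  rw [← pow_succ']
  exact Nat.pow_le_pow_right (by norm_num) (by omega)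

lemma colSum_embWord {m t K : ℕ} (hm : 1 ≤ m) (ht : 1 ≤ t) (hK : K ∣ 2 ^ (m - t))
    (v : Word (2 ^ (m - t))) (j : ℕ) : colSum K (embWord m t v) j = 0 := by
  have hle := two_mul_two_pow_sub_le hm ht
  obtain ⟨q, hq⟩ := hK
  let g : Fin (2 ^ m) → Fin (2 ^ m) := fun i =>
    if h : (i : ℕ) < 2 ^ (m - t) then ⟨i + 2 ^ (m - t), by omega⟩
    else if h2 : (i : ℕ) < 2 * 2 ^ (m - t) then ⟨i - 2 ^ (m - t), by omega⟩ else i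
  have hpos : 0 < 2 ^ (m - t) := by positivity
  have hg : ∀ i, ((g i : Fin (2 ^ m)) : ℕ) % K = (i : ℕ) % K := by
    intro i
    simp only [g]
    split_ifs with h h2
    · simp [hq]
    · have : (i : ℕ) = (i - 2 ^ (m - t)) + K * q := by omega
      conv_rhs => rw [this]
      simp
    · rfl
  refine Finset.sum_involution (fun i _ => g i) ?_ ?_ ?_ ?_
  · intro i _
    by_cases h : (i : ℕ) < 2 ^ (m - t)
    · have h4 : (i : ℕ) + 2 ^ (m - t) < 2 * 2 ^ (m - t) := by omega
      simp [g, embWord, h, h4, CharTwo.add_self_eq_zero]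
    · by_cases h2 : (i : ℕ) < 2 * 2 ^ (m - t)
      · have h3 : (i : ℕ) - 2 ^ (m - t) < 2 ^ (m - t) := by omega
        simp [g, embWord, h, h2, h3, CharTwo.add_self_eq_zero]
      · simp [g, embWord, h, h2]
  · intro i _ hi hgi
    have := congrArg Fin.val hgi
    simp only [g] at this
    split_ifs at this with h h2
    · simp only at this; omega
    · simp only at this; omega
    · simp [embWord, h, h2] at hi
  · intro i hi
    simpa [hg] using hi
  · intro i _
    apply Fin.ext
    by_cases h : (i : ℕ) < 2 ^ (m - t)
    · have h4 : (i : ℕ) + 2 ^ (m - t) < 2 * 2 ^ (m - t) := by omega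
      simp [g, h, h4]
    · by_cases h2 : (i : ℕ) < 2 * 2 ^ (m - t)
      · have h3 : (i : ℕ) - 2 ^ (m - t) < 2 ^ (m - t) := by omega
        simp only [g, h, h2, h3, dif_pos, dif_neg, not_false_eq_true]
        omega
      · simp [g, h, h2]

lemma colSum_eq_zero_of_mem_Vt {m t K : ℕ} (hm : 1 ≤ m) (ht : 1 ≤ t) (hK : K ∣ 2 ^ (m - t))
    {x : Word (2 ^ m)} (hx : x ∈ Vt m t) (j : ℕ) : colSum K x j = 0 := by
  obtain ⟨v, -, rfl⟩ := hx
  exact colSum_embWord hm ht hK v j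

lemma colSum_eq_zero_of_mem_At {m K : ℕ} (hm : 1 ≤ m) (t : ℕ) (hK : K ∣ 2 ^ (m - t))
    {x : Word (2 ^ m)} (hx : x ∈ At m t) (j : ℕ) : colSum K x j = 0 := by
  induction t using At.induct generalizing x with
  | case1 =>
    obtain rfl : x = 0 := hx
    simp [colSum]
  | case2 => exact colSum_eq_zero_of_mem_Vt hm le_rfl hK hx j
  | case3 t ih =>
    obtain ⟨v, hv, a, ha, rfl⟩ := Set.mem_add.mp hx
    rw [colSum_add, colSum_eq_zero_of_mem_Vt hm (by omega) hK hv,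
      ih (hK.trans (pow_dvd_pow 2 (by omega))) ha, add_zero]

lemma isComp_At {m : ℕ} (hm : 1 ≤ m) (t : ℕ) : IsComp m t (At m t) :=
  ⟨fun x hx => (even_hammingNorm_iff x).2 (colSum_eq_zero_of_mem_At hm t (one_dvd _) hx 0),
    rfl, rfl⟩

lemma At_eq_biUnion (m : ℕ) {t : ℕ} (ht : 2 ≤ t) :
    At m t = ⋃ μ ∈ Vt m t, (fun x => μ + x) '' At m (t - 1) := by
  obtain ⟨k, rfl⟩ := Nat.exists_eq_add_of_le' ht
  exact Set.iUnion_add_left_image.symm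

lemma Vt_apply_eq_zero {m t : ℕ} {μ : Word (2 ^ m)} (hμ : μ ∈ Vt m t) (i : Fin (2 ^ m))
    (hi : 2 * 2 ^ (m - t) ≤ (i : ℕ)) : μ i = 0 := by
  obtain ⟨v, -, rfl⟩ := hμ
  have h : ¬ (i : ℕ) < 2 ^ (m - t) := by omega
  simp [embWord, h, hi]

lemma pairwiseDisjoint_of_isComp {m t : ℕ} (ht : 2 ≤ t) (ht' : t ≤ m - 1)
    (G : Word (2 ^ m) → Set (Word (2 ^ m))) (hG : ∀ μ ∈ Vt m t, IsComp m (t - 1) (G μ)) :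
    (Vt m t).PairwiseDisjoint fun μ => (fun x => μ + x) '' G μ := by
  have hK : 2 ^ (m - (t - 1)) = 2 * 2 ^ (m - t) := by
    rw [← pow_succ']
    congr 1
    omega
  have hK3 : 3 ≤ 2 ^ (m - (t - 1)) := by
    calc 3 ≤ 2 ^ 2 := by norm_num
      _ ≤ _ := Nat.pow_le_pow_right (by norm_num) (by omega)
  have hKn : 2 ^ (m - (t - 1)) ≤ 2 ^ m := Nat.pow_le_pow_right (by norm_num) (by omega)
  have col : ∀ μ ∈ Vt m t, ∀ x ∈ (fun x => μ + x) '' G μ, ∀ a < 2 ^ (m - (t - 1)),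
      colSum (2 ^ (m - (t - 1))) x a = colSum (2 ^ (m - (t - 1))) μ a := by
    rintro μ hμ _ ⟨g, hg, rfl⟩ a ha
    have h0 : colSum (2 ^ (m - (t - 1))) g a = 0 := by
      refine colSum_eq_zero_of_nbr hK3 hKn
        (fun s hs => colSum_eq_zero_of_mem_At (by omega) (t - 1) dvd_rfl hs) (fun i => ?_) ha
      rw [← (hG μ hμ).2.2]
      exact ⟨g, hg, (hammingDist_eq_one_iff _ _).2 ⟨i, rfl⟩⟩
    simp [colSum_add, h0]
  intro μ hμ ν hν hne
  refine Set.disjoint_left.2 fun x hx hx' => hne (funext fun i => ?_)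
  have hsμ := fun i => hK ▸ Vt_apply_eq_zero hμ i
  have hsν := fun i => hK ▸ Vt_apply_eq_zero hν i
  rcases Nat.lt_or_ge (i : ℕ) (2 ^ (m - (t - 1))) with hi | hi
  · rw [← colSum_eq_apply hsμ i hi, ← colSum_eq_apply hsν i hi, ← col μ hμ x hx i hi,
      ← col ν hν x hx' i hi]
  · rw [hsμ i hi, hsν i hi]

lemma ncard_biUnion_of_isComp {m t : ℕ} (ht : 2 ≤ t) (ht' : t ≤ m - 1)
    (G : Word (2 ^ m) → Set (Word (2 ^ m))) (hG : ∀ μ ∈ Vt m t, IsComp m (t - 1) (G μ)) :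
    (⋃ μ ∈ Vt m t, (fun x => μ + x) '' G μ).ncard
      = (Vt m t).ncard * (At m (t - 1)).ncard := by
  classical
  have hd := pairwiseDisjoint_of_isComp ht ht' G hG
  have hU : (⋃ μ ∈ Vt m t, (fun x => μ + x) '' G μ)
      = ↑((Vt m t).toFinset.biUnion fun μ => ((fun x => μ + x) '' G μ).toFinset) := by
    ext
    simp
  rw [hU, Set.ncard_coe_finset, Finset.card_biUnion, Finset.sum_const_nat,
    Set.ncard_eq_toFinset_card']
  · intro μ hμ
    rw [← Set.ncard_eq_toFinset_card', Set.ncard_image_of_injective _ (add_right_injective μ)]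
    exact (hG μ (by simpa using hμ)).2.1
  · intro μ hμ ν hν hne
    exact Set.disjoint_toFinset.2 (hd (by simpa using hμ) (by simpa using hν) hne)

/-- if for each μ ∈ V^t the set B_μ is a μ-component of order t-1,
then ∪_{μ ∈ V^t} B_μ is a component of order t. -/
theorem stmt_1 (m t : ℕ) (hm : 4 ≤ m) (ht : 2 ≤ t) (ht' : t ≤ m - 1)
    (B : Word (2 ^ m) → Set (Word (2 ^ m)))
    (hB : ∀ μ ∈ Vt m t, IsMuComp m (t - 1) μ (B μ)) :
    IsComp m t (⋃ μ ∈ Vt m t, B μ) := by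
  choose! G hG hBG using fun μ hμ => (hB μ hμ).2
  rw [Set.iUnion₂_congr hBG]
  refine ⟨?_, ?_, ?_⟩
  · simp only [Set.iUnion_subset_iff]
    rintro μ hμ _ ⟨g, hg, rfl⟩
    refine (even_hammingNorm_iff _).2 ?_
    rw [colSum_add, colSum_eq_zero_of_mem_Vt (by omega) (by omega) (one_dvd _) hμ,
      (even_hammingNorm_iff g).1 ((hG μ hμ).1 hg), add_zero]
  · rw [At_eq_biUnion m ht, ncard_biUnion_of_isComp ht ht' G hG,
      ncard_biUnion_of_isComp ht ht' _ fun _ _ => isComp_At (by omega) _]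
  · rw [At_eq_biUnion m ht, nbr_biUnion, nbr_biUnion]
    refine Set.iUnion₂_congr fun μ hμ => ?_
    rw [nbr_image_add, nbr_image_add, (hG μ hμ).2.2]
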